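/- For fixed y = (y', y₃) ∈ ℝ²×[0,1], the Green function G(x,y) is differentiable in x' on {x' ≠ y'}, and there is an absolute constant c > 0 such that for all x = (x', x₃), y = (y', y₃) in ℝ²×[0,1] with x' ≠ y': |∇_{x'} G(x,y)| ≤ c / ( |x'−y'|²(1 + |x'−y'|) + |x₃−y₃|² ), and the same bound holds for |∇_{y'} G(x,y)|. -/

import Mathlib

open Real

/-- The general term of the series defining the Green function of the Laplacian on
`ℝ² × [0,1]` with Dirichlet boundary conditions; `d = |x' − y'|`. -/
noncomputable def greenTerm (d x3 y3 : ℝ) (n : ℤ) : ℝ :=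
  1 / Real.sqrt (d ^ 2 + (x3 - y3 + 2 * (n : ℝ)) ^ 2)
    - 1 / Real.sqrt (d ^ 2 + (x3 + y3 - 2 * (n : ℝ)) ^ 2)

/-- The Green function of the Laplacian on `ℝ² × [0,1]` with Dirichlet boundary
conditions. -/
noncomputable def greenG (x' : EuclideanSpace ℝ (Fin 2)) (x3 : ℝ)
    (y' : EuclideanSpace ℝ (Fin 2)) (y3 : ℝ) : ℝ :=
  (1 / (4 * π)) * ∑' n : ℤ, greenTerm (‖x' - y'‖) x3 y3 n

noncomputable def grho (d t : ℝ) : ℝ := 1 / Real.sqrt (d ^ 2 + t ^ 2)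

lemma grho_pos {d : ℝ} (hd : 0 < d) (t : ℝ) : 0 < grho d t := by
  unfold grho; positivity

lemma grho_sq {d : ℝ} (hd : 0 < d) (t : ℝ) : (d ^ 2 + t ^ 2) * grho d t ^ 2 = 1 := by
  unfold grho
  have h : 0 < d ^ 2 + t ^ 2 := by positivity
  rw [div_pow, Real.sq_sqrt h.le]
  field_simp

lemma grho_mul_le {d : ℝ} (hd : 0 < d) (t : ℝ) : d * grho d t ≤ 1 := by
  have h1 := grho_sq hd t
  have h2 := grho_pos hd t
  nlinarith [mul_nonneg (sq_nonneg t) (sq_nonneg (grho d t)), mul_pos hd h2]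

lemma abs_mul_grho_le {d : ℝ} (hd : 0 < d) (t : ℝ) : |t| * grho d t ≤ 1 := by
  have h1 := grho_sq hd t
  have h2 := grho_pos hd t
  have h3 := sq_abs t
  have : 0 ≤ |t| * grho d t := by positivity
  nlinarith [mul_pos (pow_pos hd 2) (pow_pos h2 2)]

lemma grho_hasDerivAt_left {d : ℝ} (hd : 0 < d) (t : ℝ) :
    HasDerivAt (fun d => grho d t) (-(d * grho d t ^ 3)) d := by
  unfold grho
  have h : 0 < d ^ 2 + t ^ 2 := by positivity
  have hs : 0 < Real.sqrt (d ^ 2 + t ^ 2) := Real.sqrt_pos.2 h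
  have h1 : HasDerivAt (fun d : ℝ => d ^ 2 + t ^ 2) (2 * d) d := by
    simpa using (hasDerivAt_pow 2 d).add_const (t ^ 2)
  have h2 := (h1.sqrt h.ne').inv hs.ne'
  simp only [one_div]
  refine HasDerivAt.congr_deriv h2 ?_
  field_simp

lemma grho_hasDerivAt_right {d : ℝ} (hd : 0 < d) (t : ℝ) :
    HasDerivAt (fun t => grho d t) (-(t * grho d t ^ 3)) t := by
  unfold grho
  have h : 0 < d ^ 2 + t ^ 2 := by positivity
  have hs : 0 < Real.sqrt (d ^ 2 + t ^ 2) := Real.sqrt_pos.2 h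
  have h1 : HasDerivAt (fun t : ℝ => d ^ 2 + t ^ 2) (2 * t) t := by
    simpa using (hasDerivAt_pow 2 t).const_add (d ^ 2)
  have h2 := (h1.sqrt h.ne').inv hs.ne'
  simp only [one_div]
  refine HasDerivAt.congr_deriv h2 ?_
  field_simp

lemma grho_sub_le {d : ℝ} (hd : 0 < d) (s t : ℝ) (h : |s + t| ≤ 2) :
    |grho d s - grho d t| ≤ grho d s ^ 2 + grho d t ^ 2 := by
  have p1 := grho_pos hd s
  have p2 := grho_pos hd t
  have q1 := grho_sq hd s
  have q2 := grho_sq hd t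
  have a1 := abs_mul_grho_le hd s
  have a2 := abs_mul_grho_le hd t
  set r := grho d s
  set u := grho d t
  -- (r - u)(r+u) = r²u²(t² - s²)
  have e : (r - u) * (r + u) = r ^ 2 * u ^ 2 * (t - s) * (s + t) := by
    linear_combination (-r^2) * q2 + u ^ 2 * q1
  have e2 : |r - u| * (r + u) ≤ 2 * (r * u) * (r + u) := by
    have : |r - u| * (r + u) = |(r - u) * (r + u)| := by
      rw [abs_mul, abs_of_pos (by positivity : 0 < r + u)]
    rw [this, e, abs_mul, abs_mul, abs_of_pos (by positivity : 0 < r ^ 2 * u ^ 2)]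
    have h3 : |t - s| ≤ |t| + |s| := abs_sub _ _
    have h4 : r * u * |t - s| ≤ r + u := by
      calc r * u * |t - s| ≤ r * u * (|t| + |s|) := by gcongr
        _ = r * (|t| * u) + u * (|s| * r) := by ring
        _ ≤ r * 1 + u * 1 := by gcongr
        _ = r + u := by ring
    calc r ^ 2 * u ^ 2 * |t - s| * |s + t| = (r * u) * (r * u * |t - s|) * |s + t| := by ring
      _ ≤ (r * u) * (r + u) * 2 := by gcongr
      _ = _ := by ring
  have := le_of_mul_le_mul_right e2 (by positivity)
  nlinarith [sq_nonneg (r - u)]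

lemma summ_inv : Summable (fun n : ℤ => 1 / (1 + (n : ℝ) ^ 2)) := by
  have h : Summable (fun n : ℤ => 1 / (n : ℝ) ^ 2) :=
    Real.summable_one_div_int_pow.2 (by norm_num)
  refine Summable.of_norm_bounded_eventually h ?_
  rw [Filter.eventually_cofinite]
  refine (Set.finite_singleton (0 : ℤ)).subset ?_
  intro n hn
  by_contra h0
  apply hn
  have : (n : ℝ) ≠ 0 := by exact_mod_cast h0
  rw [Real.norm_of_nonneg (by positivity)]
  have : 0 < (n : ℝ) ^ 2 := by positivity
  gcongr
  linarith

lemma sq_int_le (n t : ℝ) (h : |t - 2 * n| ≤ 2) : n ^ 2 ≤ t ^ 2 / 2 + 2 := by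
  have := abs_le.1 h
  nlinarith [sq_nonneg (t - 2 * n + t), mul_nonneg (by linarith : 0 ≤ 2 - (t - 2 * n)) (by linarith : 0 ≤ 2 + (t - 2 * n))]

lemma grho_sq_le_of {d C n t : ℝ} (hd : 0 < d) (h : n ≤ C * (d ^ 2 + t ^ 2)) (hn : 0 < n) :
    grho d t ^ 2 ≤ C * (1 / n) := by
  have h1 := grho_sq hd t
  rw [mul_one_div, le_div_iff₀ hn]
  calc grho d t ^ 2 * n ≤ grho d t ^ 2 * (C * (d ^ 2 + t ^ 2)) := by gcongr
    _ = C * ((d ^ 2 + t ^ 2) * grho d t ^ 2) := by ring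
    _ = C := by rw [h1, mul_one]

lemma grho_unif {d₀ d n t : ℝ} (h0 : 0 < d₀) (hd : d₀ < d) (h : |t - 2 * n| ≤ 2) :
    grho d t ^ 2 ≤ (3 / d₀ ^ 2 + 1) * (1 / (1 + n ^ 2)) := by
  refine grho_sq_le_of (h0.trans hd) ?_ (by positivity)
  have := sq_int_le n t h
  have h2 : 3 ≤ 3 / d₀ ^ 2 * d ^ 2 := by
    rw [div_mul_eq_mul_div, le_div_iff₀ (by positivity)]
    gcongr
  have h3 : 0 ≤ 3 / d₀ ^ 2 * t ^ 2 := by positivity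
  nlinarith [sq_nonneg d, sq_nonneg t]

noncomputable def gD (d x3 y3 : ℝ) (n : ℤ) : ℝ :=
  -(d * grho d (x3 - y3 + 2 * n) ^ 3) - -(d * grho d (x3 + y3 - 2 * n) ^ 3)

lemma d_cube_le {d : ℝ} (hd : 0 < d) (t : ℝ) : d * grho d t ^ 3 ≤ grho d t ^ 2 := by
  have := grho_mul_le hd t
  have h2 := grho_pos hd t
  calc d * grho d t ^ 3 = (d * grho d t) * grho d t ^ 2 := by ring
    _ ≤ 1 * grho d t ^ 2 := by gcongr
    _ = _ := one_mul _

lemma gD_le {d : ℝ} (hd : 0 < d) (x3 y3 : ℝ) (n : ℤ) :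
    |gD d x3 y3 n| ≤ grho d (x3 - y3 + 2 * n) ^ 2 + grho d (x3 + y3 - 2 * n) ^ 2 := by
  have h1 := d_cube_le hd (x3 - y3 + 2 * n)
  have h2 := d_cube_le hd (x3 + y3 - 2 * n)
  have h3 : 0 ≤ d * grho d (x3 - y3 + 2 * n) ^ 3 := by have := grho_pos hd (x3 - y3 + 2 * n); positivity
  have h4 : 0 ≤ d * grho d (x3 + y3 - 2 * n) ^ 3 := by have := grho_pos hd (x3 + y3 - 2 * n); positivity
  unfold gD
  rw [abs_le]; constructor <;> linarith

lemma grho_neg (d t : ℝ) : grho d (-t) = grho d t := by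
  unfold grho; rw [neg_sq]

lemma gsq_bound {d₀ d x3 y3 : ℝ} (h0 : 0 < d₀) (hd : d₀ < d) (hx : x3 ∈ Set.Icc (0:ℝ) 1)
    (hy : y3 ∈ Set.Icc (0:ℝ) 1) (n : ℤ) :
    grho d (x3 - y3 + 2 * n) ^ 2 + grho d (x3 + y3 - 2 * n) ^ 2
      ≤ 2 * (3 / d₀ ^ 2 + 1) * (1 / (1 + (n : ℝ) ^ 2)) := by
  obtain ⟨hx0, hx1⟩ := hx
  obtain ⟨hy0, hy1⟩ := hy
  have h1 := grho_unif (n := n) (t := x3 - y3 + 2 * n) h0 hd (by rw [abs_le]; constructor <;> linarith)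
  have h2 := grho_unif (n := n) (t := -(x3 + y3 - 2 * n)) h0 hd (by rw [abs_le]; constructor <;> linarith)
  rw [grho_neg] at h2
  linarith

lemma g_hasDerivAt {d x3 y3 : ℝ} (hd : 0 < d) (hx : x3 ∈ Set.Icc (0:ℝ) 1)
    (hy : y3 ∈ Set.Icc (0:ℝ) 1) :
    HasDerivAt (fun d => ∑' n : ℤ, greenTerm d x3 y3 n) (∑' n : ℤ, gD d x3 y3 n) d := by
  have h0 : 0 < d / 2 := by linarith
  have hmem : d ∈ Set.Ioi (d / 2) := by simp only [Set.mem_Ioi]; linarith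
  have hS := summ_inv.mul_left (2 * (3 / (d / 2) ^ 2 + 1))
  refine hasDerivAt_tsum_of_isPreconnected (g := fun n d => greenTerm d x3 y3 n)
    (g' := fun n d => gD d x3 y3 n) hS isOpen_Ioi
    isPreconnected_Ioi ?_ ?_ hmem ?_ hmem
  · intro n e he
    have : 0 < e := h0.trans he
    exact (grho_hasDerivAt_left this _).sub (grho_hasDerivAt_left this _)
  · intro n e he
    exact (gD_le (h0.trans he) x3 y3 n).trans (gsq_bound h0 he hx hy n)
  · refine Summable.of_norm_bounded hS fun n => ?_
    refine le_trans ?_ (gsq_bound h0 hmem hx hy n)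
    refine grho_sub_le hd _ _ ?_
    obtain ⟨hx0, hx1⟩ := hx
    rw [abs_le]; constructor <;> linarith

lemma summable_gD {d x3 y3 : ℝ} (hd : 0 < d) (hx : x3 ∈ Set.Icc (0:ℝ) 1)
    (hy : y3 ∈ Set.Icc (0:ℝ) 1) : Summable (gD d x3 y3) :=
  Summable.of_norm_bounded (summ_inv.mul_left (2 * (3 / (d / 2) ^ 2 + 1))) fun n =>
    (gD_le hd x3 y3 n).trans (gsq_bound (half_pos hd) (half_lt_self hd) hx hy n)

lemma near_bound {d n t a : ℝ} (hd : 0 < d) (hd1 : d ≤ 1) (ha : a ^ 2 ≤ 1) (hat : a ^ 2 ≤ t ^ 2)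
    (h : |t - 2 * n| ≤ 2) :
    grho d t ^ 2 ≤ 4 / (d ^ 2 + a ^ 2) * (1 / (1 + n ^ 2)) := by
  refine grho_sq_le_of hd ?_ (by positivity)
  have := sq_int_le n t h
  rw [div_mul_eq_mul_div, le_div_iff₀ (by positivity)]
  have hd2 : d ^ 2 ≤ 1 := by nlinarith
  calc (1 + n ^ 2) * (d ^ 2 + a ^ 2) ≤ (t ^ 2 / 2 + 3) * (d ^ 2 + a ^ 2) := mul_le_mul_of_nonneg_right (by linarith) (by positivity)
    _ ≤ _ := by nlinarith [sq_nonneg t]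

lemma small_case {d x3 y3 : ℝ} (hd : 0 < d) (hd1 : d ≤ 1) (hx : x3 ∈ Set.Icc (0:ℝ) 1)
    (hy : y3 ∈ Set.Icc (0:ℝ) 1) :
    |∑' n : ℤ, gD d x3 y3 n| ≤
      8 / (d ^ 2 + (x3 - y3) ^ 2) * ∑' n : ℤ, 1 / (1 + (n : ℝ) ^ 2) := by
  obtain ⟨hx0, hx1⟩ := hx
  obtain ⟨hy0, hy1⟩ := hy
  rw [← Real.norm_eq_abs]
  refine tsum_of_norm_bounded (summ_inv.hasSum.mul_left _) fun n => (gD_le hd x3 y3 n).trans ?_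
  have ha : (x3 - y3) ^ 2 ≤ 1 := by nlinarith
  have hcase : (n : ℝ) ≤ -1 ∨ (n : ℝ) = 0 ∨ 1 ≤ (n : ℝ) := by
    rcases lt_trichotomy n 0 with h | h | h
    · left; exact_mod_cast (by omega : n ≤ -1)
    · right; left; exact_mod_cast h
    · right; right; exact_mod_cast h
  have h1 := near_bound (n := n) (t := x3 - y3 + 2 * n) hd hd1 ha
    (by rcases hcase with h | h | h <;> nlinarith) (by rw [abs_le]; constructor <;> linarith)
  have h2 := near_bound (n := n) (t := -(x3 + y3 - 2 * n)) hd hd1 ha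
    (by
      rw [sq_le_sq, abs_neg]
      rcases hcase with h | h | h
      · exact (abs_le.2 ⟨by linarith, by linarith⟩).trans (le_abs_self _)
      · exact (abs_le.2 ⟨by linarith, by linarith⟩).trans (le_abs_self _)
      · exact (abs_le.2 ⟨by linarith, by linarith⟩).trans (neg_le_abs _))
    (by rw [abs_le]; constructor <;> linarith)
  rw [grho_neg] at h2
  have : 8 / (d ^ 2 + (x3 - y3) ^ 2) = 2 * (4 / (d ^ 2 + (x3 - y3) ^ 2)) := by ring
  rw [this]
  linarith

lemma telesc {e : ℝ} (he : 0 < e) :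
    HasSum (fun n : ℕ => 1 / (e + n) - 1 / (e + n + 1)) (1 / e) := by
  rw [hasSum_iff_tendsto_nat_of_nonneg]
  · have : ∀ N : ℕ, ∑ n ∈ Finset.range N, (1 / (e + n) - 1 / (e + n + 1)) = 1 / e - 1 / (e + N) := by
      intro N
      induction N with
      | zero => simp
      | succ k ih => rw [Finset.sum_range_succ, ih]; push_cast; ring
    simp only [this]
    have h : Filter.Tendsto (fun N : ℕ => 1 / (e + (N : ℝ))) Filter.atTop (nhds 0) := by
      simp only [one_div]
      exact (Filter.tendsto_atTop_add_const_left _ _ tendsto_natCast_atTop_atTop).inv_tendsto_atTop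
    simpa using h.const_sub (1 / e)
  · intro n
    rw [sub_nonneg]
    exact one_div_le_one_div_of_le (by positivity) (by linarith)

noncomputable def gF (d : ℝ) (n : ℤ) : ℝ := 1 / (d + |(n : ℝ)|) - 1 / (d + |(n : ℝ)| + 1)

lemma gF_hasSum {d : ℝ} (hd : 0 < d) : HasSum (gF d) (1 / d + 1 / (d + 1)) := by
  refine HasSum.of_nat_of_neg_add_one ?_ ?_
  · convert telesc hd using 2 with n
    simp [gF]
  · convert telesc (by linarith : 0 < d + 1) using 2 with n
    have : |((-((n : ℤ) + 1) : ℤ) : ℝ)| = n + 1 := by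
      push_cast
      rw [abs_neg, abs_of_nonneg (by positivity)]
    simp only [gF, this]
    ring_nf

lemma le_gF {d : ℝ} (hd : 1 ≤ d) (n : ℤ) : 1 / (d ^ 2 + (n : ℝ) ^ 2) ≤ 4 * gF d n := by
  unfold gF
  rw [← sq_abs (n : ℝ)]
  have : 0 ≤ |(n : ℝ)| := abs_nonneg _
  set m := |(n : ℝ)|
  rw [div_sub_div _ _ (by positivity) (by positivity), mul_div_assoc', div_le_div_iff₀ (by positivity) (by positivity)]
  nlinarith [sq_nonneg (d - m)]

lemma k_deriv {d : ℝ} (hd : 0 < d) (t : ℝ) :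
    HasDerivAt (fun t => grho d t ^ 3) (-3 * t * grho d t ^ 5) t := by
  refine HasDerivAt.congr_deriv ((grho_hasDerivAt_right hd t).pow 3) ?_
  push_cast; ring

lemma k_deriv2 {d : ℝ} (hd : 0 < d) (t : ℝ) :
    HasDerivAt (fun t => -3 * t * grho d t ^ 5) (-3 * grho d t ^ 5 + 15 * t ^ 2 * grho d t ^ 7) t := by
  have h := ((hasDerivAt_id t).const_mul (-3)).mul ((grho_hasDerivAt_right hd t).pow 5)
  refine HasDerivAt.congr_deriv h ?_
  simp; ring

lemma k2_bound {d n t : ℝ} (hd : 1 ≤ d) (h : |t - 2 * n| ≤ 2) :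
    |-3 * grho d t ^ 5 + 15 * t ^ 2 * grho d t ^ 7| ≤ 54 / d ^ 3 * (1 / (d ^ 2 + n ^ 2)) := by
  have hd0 : 0 < d := by linarith
  have p := grho_pos hd0 t
  have h1 : grho d t ^ 2 ≤ 3 * (1 / (d ^ 2 + n ^ 2)) := by
    refine grho_sq_le_of hd0 ?_ (by positivity)
    have := sq_int_le n t h
    nlinarith [sq_nonneg t]
  have h2 : t ^ 2 * grho d t ^ 2 ≤ 1 := by
    have := grho_sq hd0 t
    nlinarith [mul_pos (pow_pos hd0 2) (pow_pos p 2)]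
  have h3 : grho d t ≤ 1 / d := by
    rw [le_div_iff₀ hd0, mul_comm]; exact grho_mul_le hd0 t
  have h5 : grho d t ^ 5 ≤ 3 / d ^ 3 * (1 / (d ^ 2 + n ^ 2)) := by
    calc grho d t ^ 5 = grho d t ^ 3 * grho d t ^ 2 := by ring
      _ ≤ (1 / d) ^ 3 * (3 * (1 / (d ^ 2 + n ^ 2))) := by gcongr
      _ = _ := by ring
  have h6 : |-3 * grho d t ^ 5 + 15 * t ^ 2 * grho d t ^ 7| ≤ 18 * grho d t ^ 5 := by
    have e : 15 * t ^ 2 * grho d t ^ 7 = 15 * (t ^ 2 * grho d t ^ 2) * grho d t ^ 5 := by ring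
    have e2 : 0 ≤ t ^ 2 * grho d t ^ 2 := by positivity
    have e3 : 0 < grho d t ^ 5 := by positivity
    rw [e, abs_le]; constructor <;> nlinarith
  calc _ ≤ _ := h6
    _ ≤ 18 * (3 / d ^ 3 * (1 / (d ^ 2 + n ^ 2))) := by gcongr
    _ = _ := by ring

lemma second_diff {d n a b : ℝ} (hd : 1 ≤ d) (ha : a ∈ Set.Icc (-2:ℝ) 2) (hb : b ∈ Set.Icc (-2:ℝ) 2) :
    |(grho d (2 * n + a) ^ 3 + grho d (2 * n - a) ^ 3)
      - (grho d (2 * n + b) ^ 3 + grho d (2 * n - b) ^ 3)|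
      ≤ 16 * (54 / d ^ 3 * (1 / (d ^ 2 + n ^ 2))) := by
  have hd0 : 0 < d := by linarith
  set M := 54 / d ^ 3 * (1 / (d ^ 2 + n ^ 2)) with hM
  have hM0 : 0 ≤ M := by positivity
  have hd1 : ∀ s ∈ Set.Icc (-2:ℝ) 2, |(-3 * (2 * n + s) * grho d (2 * n + s) ^ 5)
      - (-3 * (2 * n - s) * grho d (2 * n - s) ^ 5)| ≤ 4 * M := by
    intro s hs
    have := Convex.norm_image_sub_le_of_norm_hasDerivWithin_le (C := M)
      (f := fun t => -3 * t * grho d t ^ 5)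
      (f' := fun t => -3 * grho d t ^ 5 + 15 * t ^ 2 * grho d t ^ 7)
      (s := Set.Icc (2 * n - 2) (2 * n + 2)) (x := 2 * n - s) (y := 2 * n + s)
      (fun t _ => (k_deriv2 hd0 t).hasDerivWithinAt)
      (fun t ht => k2_bound hd (by rw [abs_le]; constructor <;> linarith [ht.1, ht.2]))
      (convex_Icc _ _)
      ⟨by linarith [hs.2], by linarith [hs.1]⟩ ⟨by linarith [hs.1], by linarith [hs.2]⟩
    refine this.trans ?_
    have h4 : ‖2 * n + s - (2 * n - s)‖ ≤ 4 := by
      rw [Real.norm_eq_abs, abs_le]; constructor <;> linarith [hs.1, hs.2]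
    nlinarith
  have := Convex.norm_image_sub_le_of_norm_hasDerivWithin_le (C := 4 * M)
      (f := fun s => grho d (2 * n + s) ^ 3 + grho d (2 * n - s) ^ 3)
      (f' := fun s => (-3 * (2 * n + s) * grho d (2 * n + s) ^ 5)
      - (-3 * (2 * n - s) * grho d (2 * n - s) ^ 5))
      (s := Set.Icc (-2 : ℝ) 2) (x := b) (y := a)
      (fun s _ => (by
        have h1 := (k_deriv hd0 (2 * n + s)).comp_const_add (2 * n) s
        have h2 := (k_deriv hd0 (2 * n - s)).comp_const_sub (2 * n) s
        exact ((h1.add h2).congr_deriv (by ring)).hasDerivWithinAt))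
      hd1 (convex_Icc _ _) hb ha
  refine this.trans ?_
  have h4 : ‖a - b‖ ≤ 4 := by
    rw [Real.norm_eq_abs, abs_le]; constructor <;> linarith [ha.1, ha.2, hb.1, hb.2]
  nlinarith

lemma large_case {d x3 y3 : ℝ} (hd : 1 ≤ d) (hx : x3 ∈ Set.Icc (0:ℝ) 1)
    (hy : y3 ∈ Set.Icc (0:ℝ) 1) :
    |∑' n : ℤ, gD d x3 y3 n| ≤ 3456 / d ^ 3 := by
  have hd0 : 0 < d := by linarith
  have hs := (summable_gD hd0 hx hy).hasSum
  have hs' : HasSum (fun n : ℤ => gD d x3 y3 (-n)) (∑' n : ℤ, gD d x3 y3 n) :=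
    (Equiv.neg ℤ).hasSum_iff.2 hs
  have h2 := hs.add hs'
  have key : ‖∑' n : ℤ, (gD d x3 y3 n + gD d x3 y3 (-n))‖
      ≤ (d * 16 * 54 / d ^ 3 * 4) * (1 / d + 1 / (d + 1)) := by
    refine tsum_of_norm_bounded ((gF_hasSum hd0).mul_left _) fun n => ?_
    have h := second_diff (n := n) (a := x3 - y3) (b := x3 + y3) hd
      ⟨by linarith [hx.1, hy.2], by linarith [hx.2, hy.1]⟩
      ⟨by linarith [hx.1, hy.1], by linarith [hx.2, hy.2]⟩
    have e : gD d x3 y3 n + gD d x3 y3 (-n) = -d *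
      ((grho d (2 * n + (x3 - y3)) ^ 3 + grho d (2 * n - (x3 - y3)) ^ 3)
      - (grho d (2 * n + (x3 + y3)) ^ 3 + grho d (2 * n - (x3 + y3)) ^ 3)) := by
      unfold gD
      rw [← grho_neg d (2 * n - (x3 - y3)), ← grho_neg d (2 * n - (x3 + y3))]
      push_cast
      ring_nf
    rw [e, norm_mul, norm_neg, Real.norm_of_nonneg hd0.le, Real.norm_eq_abs]
    have h' := le_gF hd n
    calc _ ≤ d * (16 * (54 / d ^ 3 * (4 * gF d n))) := by
          refine mul_le_mul_of_nonneg_left (h.trans ?_) hd0.le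
          gcongr
      _ = _ := by ring
  rw [h2.tsum_eq, Real.norm_eq_abs, ← two_mul, abs_mul, abs_two] at key
  have h3 : 1 / d + 1 / (d + 1) ≤ 2 / d := by
    have : 1 / (d + 1) ≤ 1 / d := by gcongr; linarith
    have e : 2 / d = 1 / d + 1 / d := by ring
    linarith
  have h4 : (d * 16 * 54 / d ^ 3 * 4) * (1 / d + 1 / (d + 1)) ≤ 6912 / d ^ 3 := by
    calc _ ≤ (d * 16 * 54 / d ^ 3 * 4) * (2 / d) := by gcongr
      _ = _ := by field_simp; norm_num
  have e : 6912 / d ^ 3 = 2 * (3456 / d ^ 3) := by ring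
  linarith

lemma gD_bound : ∃ c : ℝ, 0 < c ∧ ∀ d x3 y3 : ℝ, 0 < d → x3 ∈ Set.Icc (0:ℝ) 1 →
    y3 ∈ Set.Icc (0:ℝ) 1 →
    |∑' n : ℤ, gD d x3 y3 n| ≤ c / (d ^ 2 * (1 + d) + |x3 - y3| ^ 2) := by
  have hS : 0 ≤ ∑' n : ℤ, 1 / (1 + (n : ℝ) ^ 2) := tsum_nonneg fun n => by positivity
  set S := ∑' n : ℤ, 1 / (1 + (n : ℝ) ^ 2) with hSdef
  refine ⟨16 * S + 3 * 3456, by positivity, fun d x3 y3 hd hx hy => ?_⟩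
  have ha : (x3 - y3) ^ 2 ≤ 1 := by nlinarith [hx.1, hx.2, hy.1, hy.2]
  rw [sq_abs]
  rcases le_total d 1 with h | h
  · refine (small_case hd h hx hy).trans ?_
    rw [← hSdef, div_mul_eq_mul_div, div_le_div_iff₀ (by positivity) (by positivity)]
    have : d ^ 2 * (1 + d) + (x3 - y3) ^ 2 ≤ 2 * (d ^ 2 + (x3 - y3) ^ 2) := by
      nlinarith [sq_nonneg d, sq_nonneg (x3 - y3)]
    calc _ ≤ 8 * S * (2 * (d ^ 2 + (x3 - y3) ^ 2)) := by gcongr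
      _ = 16 * S * (d ^ 2 + (x3 - y3) ^ 2) := by ring
      _ ≤ _ := by gcongr; linarith
  · refine (large_case h hx hy).trans ?_
    rw [div_le_div_iff₀ (by positivity) (by positivity)]
    have h2 : 1 ≤ d ^ 2 := by nlinarith
    have : d ^ 2 * (1 + d) + (x3 - y3) ^ 2 ≤ 3 * d ^ 3 := by nlinarith
    calc _ ≤ 3456 * (3 * d ^ 3) := by gcongr
      _ = (3 * 3456) * d ^ 3 := by ring
      _ ≤ _ := by gcongr; linarith

lemma radial {g : ℝ → ℝ} {g' : ℝ} {x y : EuclideanSpace ℝ (Fin 2)} (hxy : x ≠ y)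
    (hg : HasDerivAt g g' ‖x - y‖) :
    DifferentiableAt ℝ (fun v => (1 / (4 * π)) * g ‖v - y‖) x ∧
    ‖fderiv ℝ (fun v => (1 / (4 * π)) * g ‖v - y‖) x‖ ≤ |g'| := by
  have hN : DifferentiableAt ℝ (fun v : EuclideanSpace ℝ (Fin 2) => ‖v - y‖) x :=
    (differentiableAt_id.sub_const y).norm ℝ (sub_ne_zero.2 hxy)
  have hL : ‖fderiv ℝ (fun v : EuclideanSpace ℝ (Fin 2) => ‖v - y‖) x‖ ≤ 1 := by
    have : LipschitzWith 1 (fun v : EuclideanSpace ℝ (Fin 2) => ‖v - y‖) := by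
      refine LipschitzWith.of_dist_le_mul fun u v => ?_
      rw [NNReal.coe_one, one_mul, dist_eq_norm, dist_eq_norm]
      simpa using abs_norm_sub_norm_le (u - y) (v - y)
    simpa using norm_fderiv_le_of_lipschitz ℝ (x₀ := x) this
  have h := (hg.comp_hasFDerivAt x hN.hasFDerivAt).const_mul (1 / (4 * π))
  have h' : HasFDerivAt (fun v => (1 / (4 * π)) * g ‖v - y‖) _ x := h
  refine ⟨h'.differentiableAt, ?_⟩
  rw [h'.fderiv, norm_smul, norm_smul, Real.norm_eq_abs, Real.norm_eq_abs]
  have hp : |1 / (4 * π)| ≤ 1 := by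
    rw [abs_of_pos (by positivity), div_le_one (by positivity)]
    linarith [Real.pi_gt_three]
  calc _ ≤ 1 * (|g'| * 1) := by gcongr
    _ = _ := by ring

/-- The Green function is differentiable in the horizontal variables away
from the diagonal, and its horizontal gradients satisfy a pointwise decay bound. -/
theorem green_function_gradient_decay :
    ∃ c : ℝ, 0 < c ∧
      ∀ (x' y' : EuclideanSpace ℝ (Fin 2)) (x3 y3 : ℝ),
        x3 ∈ Set.Icc (0:ℝ) 1 → y3 ∈ Set.Icc (0:ℝ) 1 → x' ≠ y' →
        DifferentiableAt ℝ (fun v => greenG v x3 y' y3) x' ∧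
        DifferentiableAt ℝ (fun v => greenG x' x3 v y3) y' ∧
        ‖fderiv ℝ (fun v => greenG v x3 y' y3) x'‖
          ≤ c / (‖x' - y'‖ ^ 2 * (1 + ‖x' - y'‖) + |x3 - y3| ^ 2) ∧
        ‖fderiv ℝ (fun v => greenG x' x3 v y3) y'‖
          ≤ c / (‖x' - y'‖ ^ 2 * (1 + ‖x' - y'‖) + |x3 - y3| ^ 2) := by
  obtain ⟨c, hc, hb⟩ := gD_bound
  refine ⟨c, hc, fun x' y' x3 y3 hx hy hne => ?_⟩
  have hd : 0 < ‖x' - y'‖ := norm_pos_iff.2 (sub_ne_zero.2 hne)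
  have hg := g_hasDerivAt hd hx hy
  have h1 := radial hne hg
  have hg2 := hg
  rw [norm_sub_rev] at hg2
  have h2 := radial hne.symm hg2
  have e : (fun v => greenG x' x3 v y3)
      = (fun v => (1 / (4 * π)) * ∑' n : ℤ, greenTerm ‖v - x'‖ x3 y3 n) := by
    funext v
    rw [greenG, norm_sub_rev]
  rw [e]
  have hB := hb _ _ _ hd hx hy
  refine ⟨h1.1, h2.1, h1.2.trans hB, h2.2.trans ?_⟩
  rwa [norm_sub_rev y' x']
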